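/- Let k ≥ 1, let A be a unital C*-algebra, let c_1, …, c_k, s ∈ A satisfy the relations R_k, and suppose Σ_{j=1}^k c_j* s s* c_j + s* s = β·1 for some real β with 0 < β < 1. Define E_{i,j} = (β(1−β))^{-1} c_i* s c_j* c_j s* c_i for i, j ∈ {1,…,k} and E_{j,k+1} = (β(1−β))^{-1} c_j* c_j s* s for j ∈ {1,…,k}. Then these k² + k elements are mutually orthogonal projections with Σ_{i,j} E_{i,j} + Σ_j E_{j,k+1} = 1. Moreover, the elements F_{i,j} = β^{-1}(1−β)^{-1/2} s c_j s* c_i and F_{j,k+1} = (β(1−β))^{-1/2} s c_j satisfy F_{i,j}* F_{i,j} = E_{i,j}, F_{j,k+1}* F_{j,k+1} = E_{j,k+1}, and F_{i,j} F_{i,j}* = E_{1,1} = F_{j,k+1} F_{j,k+1}* for all i, j ∈ {1,…,k}. -/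

import Mathlib

/- Statement 7: if c_1, …, c_k, s satisfy R_k and Σ_j c_j* s s* c_j + s* s = β·1
   with 0 < β < 1, then the E_{i,j} (i ∈ {1,…,k}, j ∈ {1,…,k+1}) are mutually
   orthogonal projections summing to 1, and the F_{i,j} are partial isometries
   with F_{i,j}* F_{i,j} = E_{i,j} and F_{i,j} F_{i,j}* = E_{1,1}. -/

open scoped ComplexOrder

/-- The relations `R_k` (0-based indexing: `c 0` is `c_1`). -/
def SatisfiesRk {A : Type*} [CStarAlgebra A] [PartialOrder A] [StarOrderedRing A]
    {k : ℕ} [NeZero k] (c : Fin k → A) (s : A) : Prop :=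
  0 ≤ c 0 ∧
  (∀ i j : Fin k, c i * star (c j) = if i = j then c 0 ^ 2 else 0) ∧
  (∑ j : Fin k, star (c j) * c j) + star s * s = 1 ∧
  c 0 * s = s

theorem mul_star_mul_self_of_isIdempotentElem {A : Type*} [CStarAlgebra A] {x : A}
    (h : IsIdempotentElem (x * star x)) : x * star x * x = x := by
  rw [← sub_eq_zero, ← CStarRing.mul_star_self_eq_zero_iff]
  have h' : x * star x * (x * star x) = x * star x := h
  have : (x * star x * x - x) * star (x * star x * x - x) =
      x * star x * (x * star x) * (x * star x) - x * star x * (x * star x)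
        - x * star x * (x * star x) + x * star x := by
    simp only [star_sub, star_mul, star_star]
    noncomm_ring
  rw [this, h', h']
  abel

theorem isIdempotentElem_star_mul_self {A : Type*} [CStarAlgebra A] {x : A}
    (h : IsIdempotentElem (x * star x)) : IsIdempotentElem (star x * x) := by
  have : star x * x * (star x * x) = star x * (x * star x * x) := by simp only [mul_assoc]
  rw [IsIdempotentElem, this, mul_star_mul_self_of_isIdempotentElem h]

namespace SatisfiesRk

theorem star_ofReal_smul {A : Type*} [CStarAlgebra A] (r : ℝ) (x : A) :
    star ((r : ℂ) • x) = (r : ℂ) • star x := by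
  rw [star_smul]
  congr 1
  exact Complex.conj_ofReal r

theorem coeff_long {β : ℝ} (hβ0 : 0 < β) (hβ1 : β < 1) :
    ((β⁻¹ * (Real.sqrt (1 - β))⁻¹ : ℝ) : ℂ) * ((β⁻¹ * (Real.sqrt (1 - β))⁻¹ : ℝ) : ℂ) * (β : ℂ) =
      (((β * (1 - β))⁻¹ : ℝ) : ℂ) := by
  have h1 : 0 < 1 - β := sub_pos.2 hβ1
  norm_cast
  rw [mul_mul_mul_comm, ← mul_inv (Real.sqrt _), Real.mul_self_sqrt h1.le]
  field_simp

theorem coeff_short {β : ℝ} (hβ0 : 0 < β) (hβ1 : β < 1) :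
    (((Real.sqrt (β * (1 - β)))⁻¹ : ℝ) : ℂ) * (((Real.sqrt (β * (1 - β)))⁻¹ : ℝ) : ℂ) =
      (((β * (1 - β))⁻¹ : ℝ) : ℂ) := by
  have h1 : 0 < 1 - β := sub_pos.2 hβ1
  norm_cast
  rw [← mul_inv, Real.mul_self_sqrt (by positivity)]

section

variable {A : Type*} [CStarAlgebra A] {k : ℕ} {c : Fin k → A} {s : A}

theorem sum_conj {b : ℂ}
    (hb : (∑ j, star (c j) * s * star s * c j) + star s * s = b • (1 : A)) :
    ∑ j, star (c j) * (s * star s * c j) = b • (1 : A) - star s * s := by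
  rw [← hb, add_sub_cancel_right]
  simp only [mul_assoc]

theorem mul_star_short (i j : Fin k) :
    s * c i * star (s * c j) = s * (c i * star (c j)) * star s := by
  simp only [star_mul, mul_assoc]

/-- The projections `E_{i,j}`. -/
noncomputable def proj (c : Fin k → A) (s : A) (β : ℝ) (i : Fin k) (j : Fin (k + 1)) : A :=
  if h : (j : ℕ) < k then
    (((β * (1 - β))⁻¹ : ℝ) : ℂ) •
      (star (c i) * s * star (c ⟨j, h⟩) * c ⟨j, h⟩ * star s * c i)
  else
    (((β * (1 - β))⁻¹ : ℝ) : ℂ) • (star (c i) * c i * (star s * s))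

/-- The partial isometries `F_{i,j}`. -/
noncomputable def isom (c : Fin k → A) (s : A) (β : ℝ) (i : Fin k) (j : Fin (k + 1)) : A :=
  if h : (j : ℕ) < k then
    ((β⁻¹ * (Real.sqrt (1 - β))⁻¹ : ℝ) : ℂ) • (s * c ⟨j, h⟩ * star s * c i)
  else
    (((Real.sqrt (β * (1 - β)))⁻¹ : ℝ) : ℂ) • (s * c i)

theorem proj_castSucc (β : ℝ) (i j : Fin k) :
    proj c s β i j.castSucc = (((β * (1 - β))⁻¹ : ℝ) : ℂ) •
      (star (c i) * s * star (c j) * c j * star s * c i) := by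
  simp [proj]

theorem proj_last (β : ℝ) (i : Fin k) :
    proj c s β i (Fin.last k) =
      (((β * (1 - β))⁻¹ : ℝ) : ℂ) • (star (c i) * c i * (star s * s)) := by
  simp [proj]

theorem isom_castSucc (β : ℝ) (i j : Fin k) :
    isom c s β i j.castSucc =
      ((β⁻¹ * (Real.sqrt (1 - β))⁻¹ : ℝ) : ℂ) • (s * c j * star s * c i) := by
  simp [isom]

theorem isom_last (β : ℝ) (i : Fin k) :
    isom c s β i (Fin.last k) = (((Real.sqrt (β * (1 - β)))⁻¹ : ℝ) : ℂ) • (s * c i) := by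
  simp [isom]

end

variable {A : Type*} [CStarAlgebra A] [PartialOrder A] [StarOrderedRing A]
  {k : ℕ} [NeZero k] {c : Fin k → A} {s : A}

theorem star_zero (h : SatisfiesRk c s) : star (c 0) = c 0 :=
  (IsSelfAdjoint.of_nonneg h.1).star_eq

theorem mul_star_self (h : SatisfiesRk c s) (i : Fin k) : c i * star (c i) = c 0 ^ 2 := by
  simp [h.2.1 i i]

theorem mul_star_of_ne (h : SatisfiesRk c s) {i j : Fin k} (hij : i ≠ j) :
    c i * star (c j) = 0 := by
  simp [h.2.1 i j, hij]

theorem zero_mul_s (h : SatisfiesRk c s) : c 0 * s = s := h.2.2.2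

theorem zero_sq_mul_s (h : SatisfiesRk c s) : c 0 ^ 2 * s = s := by
  rw [pow_two, mul_assoc, h.zero_mul_s, h.zero_mul_s]

theorem star_s_mul_zero (h : SatisfiesRk c s) : star s * c 0 = star s := by
  simpa [h.star_zero] using congrArg star h.zero_mul_s

theorem sum_star_mul_self (h : SatisfiesRk c s) :
    ∑ j, star (c j) * c j = 1 - star s * s :=
  eq_sub_of_add_eq h.2.2.1

theorem mul_sum_star_mul (h : SatisfiesRk c s) (i : Fin k) (x : Fin k → A) :
    c i * ∑ j, star (c j) * x j = c 0 ^ 2 * x i := by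
  rw [Finset.mul_sum, Finset.sum_eq_single i]
  · rw [← mul_assoc, h.mul_star_self]
  · intro j _ hj
    rw [← mul_assoc, h.mul_star_of_ne hj.symm, zero_mul]
  · simp

theorem mul_star_s_mul_s (h : SatisfiesRk c s) (i : Fin k) :
    c i * (star s * s) = c i - c 0 ^ 2 * c i := by
  rw [← h.mul_sum_star_mul i c, h.sum_star_mul_self]
  noncomm_ring

variable {b : ℂ}

theorem s_mul_star_s_mul (h : SatisfiesRk c s)
    (hb : (∑ j, star (c j) * s * star s * c j) + star s * s = b • (1 : A)) (i : Fin k) :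
    s * star s * c i = b • c i - c i * (star s * s) := by
  have h1 := h.mul_sum_star_mul i fun j => s * star s * c j
  rw [sum_conj hb, mul_sub, mul_smul_comm, mul_one] at h1
  rw [h1, ← mul_assoc, ← mul_assoc, h.zero_sq_mul_s]

theorem s_mul_star_s_mul_s (h : SatisfiesRk c s)
    (hb : (∑ j, star (c j) * s * star s * c j) + star s * s = b • (1 : A)) :
    s * star s * s = b • s := by
  have h0 : s * star s = b • c 0 - (c 0 - c 0 ^ 2 * c 0) := by
    rw [← h.mul_star_s_mul_s, ← h.s_mul_star_s_mul hb, mul_assoc, h.star_s_mul_zero]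
  have h1 : s * star s * s = b • s - (s - s) := by
    conv_lhs => rw [h0]
    rw [sub_mul, sub_mul, smul_mul_assoc, mul_assoc, h.zero_mul_s, h.zero_sq_mul_s]
  rw [h1, sub_self, sub_zero]

theorem s_mul_star_mul_s (h : SatisfiesRk c s)
    (hb : (∑ j, star (c j) * s * star s * c j) + star s * s = b • (1 : A))
    (j : Fin k) : s * star (c j) * s = 0 := by
  have hs : s * ∑ j, star (c j) * (s * star s * c j) = 0 := by
    rw [sum_conj hb, mul_sub, mul_smul_comm, mul_one, ← mul_assoc,
      h.s_mul_star_s_mul_s hb, sub_self]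
  have hsum : ∑ j, s * star (c j) * s * star (s * star (c j) * s) = 0 := by
    rw [← zero_mul (star s), ← hs, Finset.mul_sum, Finset.sum_mul]
    simp only [star_mul, star_star, mul_assoc]
  rw [Finset.sum_eq_zero_iff_of_nonneg fun j _ => mul_star_self_nonneg _] at hsum
  exact (CStarRing.mul_star_self_eq_zero_iff _).1 (hsum j (Finset.mem_univ j))

theorem s_mul_s (h : SatisfiesRk c s)
    (hb : (∑ j, star (c j) * s * star s * c j) + star s * s = b • (1 : A)) : s * s = 0 := by
  simpa [h.star_zero, mul_assoc, h.zero_mul_s] using h.s_mul_star_mul_s hb 0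

theorem star_s_mul_mul_of_ne (h : SatisfiesRk c s)
    (hb : (∑ j, star (c j) * s * star s * c j) + star s * s = b • (1 : A)) (hb1 : b ≠ 1)
    (i : Fin k) {j : Fin k} (hj : j ≠ 0) : star s * (c j * c i) = 0 := by
  have hj0 : c j * c 0 = 0 := by simpa [h.star_zero] using h.mul_star_of_ne hj
  have h1 : star s * (c j * c i) * (star s * s) = star s * (c j * c i) := by
    have : c j * (c 0 ^ 2 * c i) = 0 := by rw [pow_two, ← mul_assoc, ← mul_assoc, hj0]; simp
    simp only [mul_assoc] at *
    rw [h.mul_star_s_mul_s, mul_sub, this, sub_zero]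
  have h2 : star s * s * (star s * s) = b • (star s * s) := by
    rw [mul_assoc, ← mul_assoc s, h.s_mul_star_s_mul_s hb, mul_smul_comm]
  have h3 : star s * (c j * c i) = b • (star s * (c j * c i)) := by
    conv_lhs => rw [← h1, ← h1, mul_assoc, h2, mul_smul_comm, h1]
  have h4 : (1 - b) • (star s * (c j * c i)) = 0 := by
    rw [sub_smul, one_smul, ← h3, sub_self]
  exact (smul_eq_zero.1 h4).resolve_left (sub_ne_zero.2 hb1.symm)

theorem commute_star_s_mul_s (h : SatisfiesRk c s)
    (hb : (∑ j, star (c j) * s * star s * c j) + star s * s = b • (1 : A)) (hb1 : b ≠ 1)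
    (i : Fin k) : Commute (star s * s) (c i) := by
  have h1 : (∑ j, star (c j) * (s * star s * c j)) * c i = s * star s * c i := by
    rw [Finset.sum_mul, Finset.sum_eq_single 0]
    · rw [h.star_zero]
      simp only [← mul_assoc, h.zero_mul_s]
      rw [mul_assoc s, h.star_s_mul_zero]
    · intro j _ hj
      simp only [mul_assoc, h.star_s_mul_mul_of_ne hb hb1 i hj, mul_zero]
    · simp
  rw [sum_conj hb, h.s_mul_star_s_mul hb, sub_mul, smul_mul_assoc, one_mul] at h1
  exact sub_right_injective h1

theorem commute_star_s_mul_s_star (h : SatisfiesRk c s)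
    (hb : (∑ j, star (c j) * s * star s * c j) + star s * s = b • (1 : A)) (hb1 : b ≠ 1)
    (i : Fin k) : Commute (star s * s) (star (c i)) := by
  simpa using (h.commute_star_s_mul_s hb hb1 i).star_star

theorem star_s_mul_s_mul_star_s (h : SatisfiesRk c s)
    (hb : (∑ j, star (c j) * s * star s * c j) + star s * s = b • (1 : A)) (hsa : star b = b) :
    star s * s * star s = b • star s := by
  simpa [mul_assoc, ← starRingEnd_apply, show (starRingEnd ℂ) b = b from hsa]
    using congrArg star (h.s_mul_star_s_mul_s hb)

theorem mul_star_long (h : SatisfiesRk c s)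
    (hb : (∑ j, star (c j) * s * star s * c j) + star s * s = b • (1 : A)) (hb1 : b ≠ 1)
    (hsa : star b = b) (i j j' : Fin k) :
    s * c j * star s * c i * star (s * c j' * star s * c i) =
      b • (s * (c j * star (c j')) * star s) := by
  calc _ = s * c j * (star s * ((c i * star (c i)) * s)) * star (c j') * star s := by
        simp only [star_mul, star_star, mul_assoc]
    _ = s * c j * (star s * s * star (c j')) * star s := by
        rw [h.mul_star_self, h.zero_sq_mul_s]; simp only [mul_assoc]
    _ = s * (c j * star (c j')) * (star s * s * star s) := by
        rw [(h.commute_star_s_mul_s_star hb hb1 j').eq]; simp only [mul_assoc]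
    _ = _ := by rw [h.star_s_mul_s_mul_star_s hb hsa, mul_smul_comm]

theorem long_mul_star_of_ne (h : SatisfiesRk c s) {i i' : Fin k} (hi : i ≠ i') (x y : A) :
    x * c i * star (y * c i') = 0 := by
  rw [star_mul, mul_assoc, ← mul_assoc (c i), h.mul_star_of_ne hi, zero_mul, mul_zero]

theorem long_mul_star_short (h : SatisfiesRk c s)
    (hb : (∑ j, star (c j) * s * star s * c j) + star s * s = b • (1 : A)) (i j : Fin k) :
    s * c j * star s * c i * star (s * c i) = 0 := by
  have h1 : star s * star s = 0 := by rw [← star_mul, h.s_mul_s hb, _root_.star_zero]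
  have h2 : star s * c 0 ^ 2 = star s := by
    rw [pow_two, ← mul_assoc, h.star_s_mul_zero, h.star_s_mul_zero]
  calc _ = s * c j * (star s * (c i * star (c i)) * star s) := by
        simp only [star_mul, mul_assoc]
    _ = 0 := by rw [h.mul_star_self, h2, h1, mul_zero]

theorem star_mul_long (h : SatisfiesRk c s)
    (hb : (∑ j, star (c j) * s * star s * c j) + star s * s = b • (1 : A)) (hb1 : b ≠ 1)
    (hsa : star b = b) (i j : Fin k) :
    star (s * c j * star s * c i) * (s * c j * star s * c i) =
      b • (star (c i) * s * star (c j) * c j * star s * c i) := by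
  calc _ = star (c i) * s * star (c j) * (star s * s * c j) * star s * c i := by
        simp only [star_mul, star_star, mul_assoc]
    _ = star (c i) * s * star (c j) * c j * (star s * s * star s) * c i := by
        rw [(h.commute_star_s_mul_s hb hb1 j).eq]; simp only [mul_assoc]
    _ = _ := by rw [h.star_s_mul_s_mul_star_s hb hsa, mul_smul_comm, smul_mul_assoc]

theorem star_mul_short (h : SatisfiesRk c s)
    (hb : (∑ j, star (c j) * s * star s * c j) + star s * s = b • (1 : A)) (hb1 : b ≠ 1)
    (i : Fin k) : star (s * c i) * (s * c i) = star (c i) * c i * (star s * s) := by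
  calc _ = star (c i) * (star s * s * c i) := by simp only [star_mul, mul_assoc]
    _ = _ := by rw [(h.commute_star_s_mul_s hb hb1 i).eq, mul_assoc]

theorem corner_mul_self (h : SatisfiesRk c s)
    (hb : (∑ j, star (c j) * s * star s * c j) + star s * s = b • (1 : A)) (hb1 : b ≠ 1)
    (hsa : star b = b) :
    s * c 0 ^ 2 * star s * (s * c 0 ^ 2 * star s) = (b * (1 - b)) • (s * c 0 ^ 2 * star s) := by
  have hz : s * star s * c 0 = b • c 0 - (c 0 - c 0 ^ 2 * c 0) := by
    rw [← h.mul_star_s_mul_s, ← h.s_mul_star_s_mul hb]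
  have hss : s * (s * star s * c 0) = 0 := by
    rw [← mul_assoc, ← mul_assoc, h.s_mul_s hb, zero_mul, zero_mul]
  have hc : star s * s * c 0 ^ 2 = c 0 ^ 2 * (star s * s) :=
    ((h.commute_star_s_mul_s hb hb1 0).pow_right 2).eq
  have h3 : s * (c 0 ^ 2 * c 0) = (1 - b) • (s * c 0) := by
    rw [hz, mul_sub, mul_sub, mul_smul_comm] at hss
    rw [sub_smul, one_smul]
    rw [← sub_eq_zero, ← hss]
    abel
  calc _ = s * c 0 ^ 2 * (star s * s * c 0 ^ 2) * star s := by simp only [mul_assoc]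
    _ = s * (c 0 ^ 2 * c 0) * c 0 * (star s * s * star s) := by
        rw [hc]; simp only [mul_assoc, pow_two]
    _ = _ := by
        rw [h3, h.star_s_mul_s_mul_star_s hb hsa]
        simp only [smul_mul_assoc, mul_smul_comm, smul_smul, pow_two, mul_assoc]

theorem sum_long_add_sum_short (h : SatisfiesRk c s)
    (hb : (∑ j, star (c j) * s * star s * c j) + star s * s = b • (1 : A))
    (hsa : star b = b) :
    ∑ i, ((∑ j, star (c i) * s * star (c j) * c j * star s * c i) +
      star (c i) * c i * (star s * s)) = (b * (1 - b)) • (1 : A) := by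
  have h1 (i : Fin k) : ∑ j, star (c i) * s * star (c j) * c j * star s * c i =
      (1 - b) • (star (c i) * (s * star s * c i)) := by
    calc _ = star (c i) * s * (∑ j, star (c j) * c j) * star s * c i := by
          simp only [Finset.mul_sum, Finset.sum_mul, mul_assoc]
      _ = star (c i) * (s * star s * c i) - star (c i) * s * (star s * s * star s) * c i := by
          rw [h.sum_star_mul_self]; noncomm_ring
      _ = _ := by
          rw [h.star_s_mul_s_mul_star_s hb hsa]
          simp only [mul_smul_comm, smul_mul_assoc, sub_smul, one_smul, mul_assoc]
  have h2 : star s * s * (star s * s) = b • (star s * s) := by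
    rw [← mul_assoc, h.star_s_mul_s_mul_star_s hb hsa, smul_mul_assoc]
  rw [Finset.sum_add_distrib, ← Finset.sum_mul, h.sum_star_mul_self, sub_mul, one_mul, h2]
  simp only [h1]
  rw [← Finset.smul_sum, sum_conj hb]
  module

variable {β : ℝ}

theorem star_isom_mul_isom (h : SatisfiesRk c s) (hβ0 : 0 < β) (hβ1 : β < 1)
    (hβ : (∑ j, star (c j) * s * star s * c j) + star s * s = (β : ℂ) • (1 : A))
    (i : Fin k) (j : Fin (k + 1)) :
    star (isom c s β i j) * isom c s β i j = proj c s β i j := by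
  have hb1 : (β : ℂ) ≠ 1 := by exact_mod_cast hβ1.ne
  refine Fin.lastCases ?_ (fun j => ?_) j
  · rw [isom_last, proj_last, star_ofReal_smul, smul_mul_smul_comm, coeff_short hβ0 hβ1,
      h.star_mul_short hβ hb1]
  · rw [isom_castSucc, proj_castSucc, star_ofReal_smul, smul_mul_smul_comm,
      h.star_mul_long hβ hb1 (Complex.conj_ofReal β), smul_smul, coeff_long hβ0 hβ1]

theorem isom_mul_star_isom (h : SatisfiesRk c s) (hβ0 : 0 < β) (hβ1 : β < 1)
    (hβ : (∑ j, star (c j) * s * star s * c j) + star s * s = (β : ℂ) • (1 : A))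
    (i : Fin k) (j : Fin (k + 1)) :
    isom c s β i j * star (isom c s β i j) =
      (((β * (1 - β))⁻¹ : ℝ) : ℂ) • (s * c 0 ^ 2 * star s) := by
  have hb1 : (β : ℂ) ≠ 1 := by exact_mod_cast hβ1.ne
  refine Fin.lastCases ?_ (fun j => ?_) j
  · rw [isom_last, star_ofReal_smul, smul_mul_smul_comm, coeff_short hβ0 hβ1,
      mul_star_short, h.mul_star_self]
  · rw [isom_castSucc, star_ofReal_smul, smul_mul_smul_comm,
      h.mul_star_long hβ hb1 (Complex.conj_ofReal β), smul_smul, coeff_long hβ0 hβ1,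
      h.mul_star_self]

theorem isom_mul_star_isom_of_ne (h : SatisfiesRk c s) (hβ1 : β < 1)
    (hβ : (∑ j, star (c j) * s * star s * c j) + star s * s = (β : ℂ) • (1 : A))
    {i i' : Fin k} {j j' : Fin (k + 1)} (hne : (i, j) ≠ (i', j')) :
    isom c s β i j * star (isom c s β i' j') = 0 := by
  have hb1 : (β : ℂ) ≠ 1 := by exact_mod_cast hβ1.ne
  by_cases hi : i = i'
  · subst hi
    have hj : j ≠ j' := fun hj => hne (by rw [hj])
    induction j using Fin.lastCases with
    | last =>
      induction j' using Fin.lastCases with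
      | last => exact absurd rfl hj
      | cast j' =>
        rw [← star_star (isom c s β i _), ← star_mul, isom_castSucc, isom_last,
          star_ofReal_smul, smul_mul_smul_comm, h.long_mul_star_short hβ, smul_zero,
          _root_.star_zero]
    | cast j =>
      induction j' using Fin.lastCases with
      | last =>
        rw [isom_castSucc, isom_last, star_ofReal_smul, smul_mul_smul_comm,
          h.long_mul_star_short hβ, smul_zero]
      | cast j' =>
        have hj' : j ≠ j' := fun hj' => hj (by rw [hj'])
        rw [isom_castSucc, isom_castSucc, star_ofReal_smul, smul_mul_smul_comm,
          h.mul_star_long hβ hb1 (Complex.conj_ofReal β), h.mul_star_of_ne hj']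
        simp
  · have hF (i : Fin k) (j : Fin (k + 1)) : ∃ x, isom c s β i j = x * c i := by
      unfold isom
      split
      · exact ⟨_, (smul_mul_assoc _ _ _).symm⟩
      · exact ⟨_, (smul_mul_assoc _ _ _).symm⟩
    obtain ⟨x, hx⟩ := hF i j
    obtain ⟨y, hy⟩ := hF i' j'
    rw [hx, hy, h.long_mul_star_of_ne hi]

theorem proj_zero_zero (h : SatisfiesRk c s) :
    proj c s β 0 0 = (((β * (1 - β))⁻¹ : ℝ) : ℂ) • (s * c 0 ^ 2 * star s) := by
  have h0 : (0 : Fin (k + 1)) = (0 : Fin k).castSucc := by simp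
  rw [h0, proj_castSucc, h.star_zero, h.zero_mul_s, mul_assoc _ (star s), h.star_s_mul_zero,
    mul_assoc s, ← pow_two]

theorem isIdempotentElem_isom_mul_star_isom (h : SatisfiesRk c s) (hβ0 : 0 < β) (hβ1 : β < 1)
    (hβ : (∑ j, star (c j) * s * star s * c j) + star s * s = (β : ℂ) • (1 : A))
    (i : Fin k) (j : Fin (k + 1)) :
    IsIdempotentElem (isom c s β i j * star (isom c s β i j)) := by
  have hb1 : (β : ℂ) ≠ 1 := by exact_mod_cast hβ1.ne
  have h1 : (β : ℂ) * (1 - β) ≠ 0 :=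
    mul_ne_zero (by exact_mod_cast hβ0.ne') (sub_ne_zero.2 hb1.symm)
  rw [h.isom_mul_star_isom hβ0 hβ1 hβ, IsIdempotentElem, smul_mul_smul_comm,
    h.corner_mul_self hβ hb1 (Complex.conj_ofReal β), smul_smul]
  congr 1
  push_cast
  rw [mul_assoc, inv_mul_cancel₀ h1, mul_one]

theorem sum_proj (h : SatisfiesRk c s) (hβ0 : 0 < β) (hβ1 : β < 1)
    (hβ : (∑ j, star (c j) * s * star s * c j) + star s * s = (β : ℂ) • (1 : A)) :
    ∑ i, ∑ j, proj c s β i j = 1 := by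
  have hb1 : (β : ℂ) ≠ 1 := by exact_mod_cast hβ1.ne
  have h1 : (β : ℂ) * (1 - β) ≠ 0 :=
    mul_ne_zero (by exact_mod_cast hβ0.ne') (sub_ne_zero.2 hb1.symm)
  simp only [Fin.sum_univ_castSucc, proj_castSucc, proj_last, ← Finset.smul_sum, ← smul_add]
  rw [h.sum_long_add_sum_short hβ (Complex.conj_ofReal β), smul_smul]
  push_cast
  rw [inv_mul_cancel₀ h1, one_smul]

end SatisfiesRk

theorem stmt7 {A : Type*} [CStarAlgebra A] [PartialOrder A] [StarOrderedRing A]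
    (k : ℕ) [NeZero k] (hk : 1 ≤ k) (c : Fin k → A) (s : A)
    (hRk : SatisfiesRk c s) (β : ℝ) (hβ0 : 0 < β) (hβ1 : β < 1)
    (hβ : (∑ j : Fin k, star (c j) * s * star s * c j) + star s * s = (β : ℂ) • (1 : A)) :
    -- E : for j < k, E_{i,j} = (β(1-β))⁻¹ c_i* s c_j* c_j s* c_i;
    --     for j = k+1, E_{i,k+1} = (β(1-β))⁻¹ c_i* c_i s* s
    letI E : Fin k → Fin (k + 1) → A := fun i j =>
      if h : (j : ℕ) < k then
        (((β * (1 - β))⁻¹ : ℝ) : ℂ) •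
          (star (c i) * s * star (c ⟨j, h⟩) * c ⟨j, h⟩ * star s * c i)
      else
        (((β * (1 - β))⁻¹ : ℝ) : ℂ) • (star (c i) * c i * (star s * s))
    letI F : Fin k → Fin (k + 1) → A := fun i j =>
      if h : (j : ℕ) < k then
        ((β⁻¹ * (Real.sqrt (1 - β))⁻¹ : ℝ) : ℂ) • (s * c ⟨j, h⟩ * star s * c i)
      else
        (((Real.sqrt (β * (1 - β)))⁻¹ : ℝ) : ℂ) • (s * c i)
    -- the E's are mutually orthogonal projections summing to 1
    (∀ i j, IsSelfAdjoint (E i j) ∧ E i j * E i j = E i j) ∧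
    (∀ i j i' j', (i, j) ≠ (i', j') → E i j * E i' j' = 0) ∧
    (∑ i, ∑ j, E i j = 1) ∧
    -- the F's implement equivalences between the E's and E_{1,1}
    (∀ i j, star (F i j) * F i j = E i j) ∧
    (∀ i j, F i j * star (F i j) = E 0 0) := by
  have hEF := hRk.star_isom_mul_isom hβ0 hβ1 hβ
  have hproj : ∀ i j, IsSelfAdjoint (SatisfiesRk.proj c s β i j) ∧
      SatisfiesRk.proj c s β i j * SatisfiesRk.proj c s β i j = SatisfiesRk.proj c s β i j := by
    intro i j
    rw [← hEF]
    exact ⟨.star_mul_self _, isIdempotentElem_star_mul_self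
      (hRk.isIdempotentElem_isom_mul_star_isom hβ0 hβ1 hβ i j)⟩
  have horth : ∀ i j i' j', (i, j) ≠ (i', j') →
      SatisfiesRk.proj c s β i j * SatisfiesRk.proj c s β i' j' = 0 := by
    intro i j i' j' hne
    rw [← hEF, ← hEF, mul_assoc, ← mul_assoc (SatisfiesRk.isom c s β i j),
      hRk.isom_mul_star_isom_of_ne hβ1 hβ hne, zero_mul, mul_zero]
  exact ⟨hproj, horth, hRk.sum_proj hβ0 hβ1 hβ, hEF,
    fun i j => (hRk.isom_mul_star_isom hβ0 hβ1 hβ i j).trans hRk.proj_zero_zero.symm⟩
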